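/- Let I ⊆ ℝ be a nonempty open interval and let f₁,…,f_m be a Pfaffian chain on I. If a real analytic function g : I → ℝ is algebraic over (x, f₁,…,f_m), then for every natural number r the r-th derivative g^{(r)} is algebraic over (x, f₁,…,f_m), i.e., for each r there is a nonzero polynomial Q_r ∈ ℝ[X₀,…,X_m,Y] with Q_r(x, f₁(x),…,f_m(x), g^{(r)}(x)) = 0 for all x ∈ I. (This is the closure-under-differentiation property of functions algebraic over a Pfaffian chain, used in the proofs of Theorems A and B.) -/

import Mathlib

open MvPolynomial

noncomputable section

/-- `g₁,…,g_r` are algebraically dependent over `(x, h₁,…,h_k)` on `I`. -/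
def AlgDepOn (I : Set ℝ) {k r : ℕ} (h : Fin k → ℝ → ℝ) (g : Fin r → ℝ → ℝ) : Prop :=
  ∃ P : MvPolynomial (Fin (k + 1 + r)) ℝ, P ≠ 0 ∧
    ∀ x ∈ I, MvPolynomial.eval
      (Fin.append (Fin.cons x fun j => h j x) fun j => g j x) P = 0

/-- `g` is algebraic over `(x, h₁,…,h_k)` on `I`. -/
def AlgebraicOver (I : Set ℝ) {k : ℕ} (h : Fin k → ℝ → ℝ) (g : ℝ → ℝ) : Prop :=
  AlgDepOn I h ![g]

/-- A Pfaffian chain on `I` (in the algebraic sense): a finite list of real analytic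
functions `f₁,…,f_m : I → ℝ` such that each `fᵢ'` is algebraic over `(x, f₁,…,fᵢ)`. -/
def IsPfaffianChain (I : Set ℝ) {m : ℕ} (f : Fin m → ℝ → ℝ) : Prop :=
  (∀ i, AnalyticOnNhd ℝ (f i) I) ∧
  ∀ i : Fin m, AlgebraicOver I (fun j : Fin ((i : ℕ) + 1) => f (Fin.castLE i.isLt j))
    (deriv (f i))

/-- `g` satisfies the strong-minimality dichotomy of order `n` on `I`. -/
def StrongMinDichotomy (I : Set ℝ) (n : ℕ) (g : ℝ → ℝ) : Prop :=
  ∀ (k : ℕ) (h : Fin k → ℝ → ℝ),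
    (∀ i, AnalyticOnNhd ℝ (h i) I) →
    (∀ i, AlgebraicOver I h (deriv (h i))) →
    (¬ AlgDepOn I h fun j : Fin n => deriv^[(j : ℕ)] g) ∨ AlgebraicOver I h g

section Derivation

variable {A : Type*} [CommRing A] [IsDomain A] [Algebra ℝ A]

theorem Derivation.isAlgebraic_of_mem_adjoin (D : Derivation ℝ A A) {s : Set A}
    (hs : ∀ y ∈ s, IsAlgebraic (Algebra.adjoin ℝ s) (D y)) {y : A}
    (hy : y ∈ Algebra.adjoin ℝ s) : IsAlgebraic (Algebra.adjoin ℝ s) (D y) := by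
  have hmem : ∀ z, z ∈ Algebra.adjoin ℝ s → IsAlgebraic (Algebra.adjoin ℝ s) z := fun z hz =>
    isAlgebraic_algebraMap (⟨z, hz⟩ : Algebra.adjoin ℝ s)
  induction hy using Algebra.adjoin_induction with
  | mem y hy => exact hs y hy
  | algebraMap r => rw [D.map_algebraMap]; exact isAlgebraic_zero
  | add y z _ _ ihy ihz => rw [map_add]; exact ihy.add ihz
  | mul y z hy hz ihy ihz =>
    rw [D.leibniz, smul_eq_mul, smul_eq_mul]
    exact ((hmem y hy).mul ihz).add ((hmem z hz).mul ihy)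

/-- A derivation that maps a subalgebra into the elements algebraic over it satisfies the chain
rule for polynomials over that subalgebra, up to an element algebraic over it. -/
theorem Derivation.isAlgebraic_aeval_sub (D : Derivation ℝ A A) {S : Subalgebra ℝ A}
    (hS : ∀ y ∈ S, IsAlgebraic S (D y)) {g : A} (hg : IsAlgebraic S g) (p : Polynomial S) :
    IsAlgebraic S (D (Polynomial.aeval g p) - Polynomial.aeval g p.derivative * D g) := by
  induction p using Polynomial.induction_on' with
  | add p q hp hq =>
    convert! hp.add hq using 1
    simp only [map_add]
    ring
  | monomial n c =>
    have hc : algebraMap S A c = c := rfl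
    convert! (hg.pow n).mul (hS c c.2) using 1
    simp only [Polynomial.derivative_monomial, Polynomial.aeval_monomial, D.leibniz,
      D.leibniz_pow, smul_eq_mul, nsmul_eq_mul, map_mul, _root_.map_natCast, hc]
    ring

theorem Derivation.isAlgebraic_of_isAlgebraic (D : Derivation ℝ A A) {S : Subalgebra ℝ A}
    (hS : ∀ y ∈ S, IsAlgebraic S (D y)) {g : A} (hg : IsAlgebraic S g) :
    IsAlgebraic S (D g) := by
  have : CharZero S := charZero_of_injective_algebraMap (algebraMap ℝ S).injective
  obtain ⟨p, hp0, hp⟩ := hg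
  induction hn : p.natDegree using Nat.strong_induction_on generalizing p with
  | _ n ih =>
    have hder : p.derivative ≠ 0 := by
      intro h
      rw [Polynomial.eq_C_of_derivative_eq_zero h, Polynomial.aeval_C] at hp
      apply hp0
      rw [Polynomial.eq_C_of_derivative_eq_zero h, show p.coeff 0 = 0 from Subtype.ext hp,
        Polynomial.C_0]
    by_cases hroot : Polynomial.aeval g p.derivative = 0
    · refine ih _ ?_ _ hder hroot rfl
      rw [← hn]
      apply Polynomial.natDegree_derivative_lt
      intro h
      apply hder
      rw [Polynomial.eq_C_of_natDegree_eq_zero h, Polynomial.derivative_C]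
    · have hgalg : IsAlgebraic S g := ⟨p, hp0, hp⟩
      have h := (D.isAlgebraic_aeval_sub hS hgalg p).neg
      rw [hp, map_zero, zero_sub, neg_neg] at h
      exact .of_mul (mem_nonZeroDivisors_of_ne_zero hroot)
        (Algebra.isAlgebraic_adjoin_singleton_iff.2 hgalg _
          (Polynomial.aeval_mem_adjoin_singleton S g)) h

end Derivation

/-- The algebra of real functions on `I` that are restrictions of functions analytic on `I`. -/
def analyticSubalgebra (I : Set ℝ) : Subalgebra ℝ (I → ℝ) where
  carrier := {φ | ∃ F : ℝ → ℝ, AnalyticOnNhd ℝ F I ∧ φ = I.domRestrict F}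
  mul_mem' := by
    rintro _ _ ⟨F, hF, rfl⟩ ⟨G, hG, rfl⟩
    exact ⟨F * G, hF.mul hG, rfl⟩
  add_mem' := by
    rintro _ _ ⟨F, hF, rfl⟩ ⟨G, hG, rfl⟩
    exact ⟨F + G, hF.add hG, rfl⟩
  algebraMap_mem' r := ⟨fun _ => r, analyticOnNhd_const, rfl⟩

namespace analyticSubalgebra

variable {I : Set ℝ}

/-- The restriction to `I` of a function analytic on `I`. -/
def mk (F : ℝ → ℝ) (hF : AnalyticOnNhd ℝ F I) : analyticSubalgebra I :=
  ⟨I.domRestrict F, F, hF, rfl⟩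

theorem exists_eq_mk (φ : analyticSubalgebra I) : ∃ F hF, φ = mk F hF := by
  obtain ⟨_, F, hF, rfl⟩ := φ
  exact ⟨F, hF, rfl⟩

theorem mk_eq_mk {F G : ℝ → ℝ} {hF : AnalyticOnNhd ℝ F I} {hG : AnalyticOnNhd ℝ G I} :
    mk F hF = mk G hG ↔ Set.EqOn F G I := by
  simp [mk, Subtype.ext_iff, Set.domRestrict_eq_domRestrict_iff]

theorem isDomain (hne : I.Nonempty) (hI : IsPreconnected I) :
    IsDomain (analyticSubalgebra I) := by
  have : Nonempty I := hne.to_subtype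
  have : NoZeroDivisors (analyticSubalgebra I) := by
    refine ⟨fun {φ ψ} h => ?_⟩
    obtain ⟨F, hF, rfl⟩ := exists_eq_mk φ
    obtain ⟨G, hG, rfl⟩ := exists_eq_mk ψ
    have h0 : (0 : analyticSubalgebra I) = mk 0 analyticOnNhd_const := rfl
    have hFG : Set.EqOn (F * G) 0 I := (mk_eq_mk (hF := hF.mul hG)).1 (h.trans h0)
    rw [h0, mk_eq_mk, mk_eq_mk]
    exact hF.eq_zero_or_eq_zero_of_mul_eq_zero hG hFG hI
  exact NoZeroDivisors.to_isDomain _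

/-- The derivative of an analytic function, computed from any extension. -/
def derivFun (φ : analyticSubalgebra I) : analyticSubalgebra I :=
  mk (deriv (exists_eq_mk φ).choose) (exists_eq_mk φ).choose_spec.choose.deriv

theorem derivFun_mk (hI : IsOpen I) (F : ℝ → ℝ) (hF : AnalyticOnNhd ℝ F I) :
    derivFun (mk F hF) = mk (deriv F) hF.deriv := by
  have h := (exists_eq_mk (mk F hF)).choose_spec.choose_spec
  rw [mk_eq_mk] at h
  rw [derivFun, mk_eq_mk]
  exact h.symm.deriv hI

/-- Differentiation of analytic functions on an open set. -/
def derivation (hI : IsOpen I) : Derivation ℝ (analyticSubalgebra I) (analyticSubalgebra I) :=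
  Derivation.mk'
    { toFun := derivFun
      map_add' := fun φ ψ => by
        obtain ⟨F, hF, rfl⟩ := exists_eq_mk φ
        obtain ⟨G, hG, rfl⟩ := exists_eq_mk ψ
        have h : mk F hF + mk G hG = mk (F + G) (hF.add hG) := rfl
        rw [h, derivFun_mk hI, derivFun_mk hI, derivFun_mk hI]
        refine Subtype.ext (funext fun x => ?_)
        exact deriv_add (hF x x.2).differentiableAt (hG x x.2).differentiableAt
      map_smul' := fun r φ => by
        obtain ⟨F, hF, rfl⟩ := exists_eq_mk φ
        have h : r • mk F hF = mk (r • F) hF.const_smul := rfl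
        rw [h, derivFun_mk hI, derivFun_mk hI]
        refine Subtype.ext (funext fun x => ?_)
        exact deriv_const_smul r (hF x x.2).differentiableAt }
    fun φ ψ => by
      obtain ⟨F, hF, rfl⟩ := exists_eq_mk φ
      obtain ⟨G, hG, rfl⟩ := exists_eq_mk ψ
      have h : mk F hF * mk G hG = mk (F * G) (hF.mul hG) := rfl
      rw [LinearMap.coe_mk, AddHom.coe_mk, h, derivFun_mk hI, derivFun_mk hI, derivFun_mk hI]
      refine Subtype.ext (funext fun x => ?_)
      refine (deriv_mul (hF x x.2).differentiableAt (hG x x.2).differentiableAt).trans ?_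
      change _ = F x * deriv G x + G x * deriv F x
      ring

theorem derivation_mk (hI : IsOpen I) (F : ℝ → ℝ) (hF : AnalyticOnNhd ℝ F I) :
    derivation hI (mk F hF) = mk (deriv F) hF.deriv :=
  derivFun_mk hI F hF

/-- The tuple `(x, h₁,…,h_k)` of analytic functions on `I`. -/
def consId {k : ℕ} (h : Fin k → ℝ → ℝ) (hh : ∀ i, AnalyticOnNhd ℝ (h i) I) :
    Fin (k + 1) → analyticSubalgebra I :=
  Fin.cons (mk id analyticOnNhd_id) fun i => mk (h i) (hh i)

theorem coe_aeval_apply {σ : Type*} (v : σ → analyticSubalgebra I) (P : MvPolynomial σ ℝ) (x : I) :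
    (aeval v P : I → ℝ) x = eval (fun i => (v i : I → ℝ) x) P := by
  rw [← aeval_eq_eval]
  exact DFunLike.congr_fun
    (comp_aeval v ((Pi.evalAlgHom ℝ (fun _ : I => ℝ) x).comp (analyticSubalgebra I).val)) P

theorem algebraicOver_iff_not_algebraicIndependent {k : ℕ} {h : Fin k → ℝ → ℝ}
    (hh : ∀ i, AnalyticOnNhd ℝ (h i) I) {g : ℝ → ℝ} (hg : AnalyticOnNhd ℝ g I) :
    AlgebraicOver I h g ↔ ¬ AlgebraicIndependent ℝ
      (Fin.snoc (consId h hh) (mk g hg) : Fin (k + 1 + 1) → analyticSubalgebra I) := by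
  have hval : ∀ x : I, (Fin.append (Fin.cons (x : ℝ) fun j => h j x) fun j => ![g] j x) =
      fun i => ((Fin.snoc (consId h hh) (mk g hg) : Fin (k + 1 + 1) → analyticSubalgebra I) i :
        I → ℝ) x := by
    intro x
    rw [Fin.append_right_eq_snoc]
    ext i
    refine Fin.lastCases ?_ (fun i => ?_) i
    · simp [mk]
    · rw [Fin.snoc_castSucc, Fin.snoc_castSucc]
      refine Fin.cases ?_ (fun i => ?_) i <;> simp [consId, mk]
  rw [algebraicIndependent_iff, AlgebraicOver, AlgDepOn]
  push Not
  refine exists_congr fun P => and_comm.trans (and_congr_left' ?_)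
  rw [Subtype.ext_iff, _root_.funext_iff, Subtype.forall]
  refine forall₂_congr fun x hx => ?_
  rw [coe_aeval_apply, hval ⟨x, hx⟩]
  rfl

theorem algebraicOver_iff {k : ℕ} {h : Fin k → ℝ → ℝ}
    (hh : ∀ i, AnalyticOnNhd ℝ (h i) I) {g : ℝ → ℝ} (hg : AnalyticOnNhd ℝ g I) :
    AlgebraicOver I h g ↔ (AlgebraicIndependent ℝ (consId h hh) →
      IsAlgebraic (Algebra.adjoin ℝ (Set.range (consId h hh))) (mk g hg)) := by
  have hsnoc : (Fin.snoc (consId h hh) (mk g hg) : Fin (k + 1 + 1) → analyticSubalgebra I) =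
      (fun o : Option (Fin (k + 1)) => o.elim (mk g hg) (consId h hh)) ∘ finSuccEquivLast := by
    ext1 i
    refine Fin.lastCases ?_ (fun i => ?_) i <;> simp
  rw [algebraicOver_iff_not_algebraicIndependent hh hg, hsnoc, algebraicIndependent_equiv,
    AlgebraicIndependent.option_iff, Transcendental]
  tauto

end analyticSubalgebra

open analyticSubalgebra in
theorem AlgebraicOver.deriv_of_isPfaffianChain {I : Set ℝ} (hne : I.Nonempty) (hI : IsOpen I)
    (hI' : IsPreconnected I) {m : ℕ} {f : Fin m → ℝ → ℝ} (hf : IsPfaffianChain I f)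
    {g : ℝ → ℝ} (hg : AnalyticOnNhd ℝ g I) (halg : AlgebraicOver I f g) :
    AlgebraicOver I f (deriv g) := by
  have := analyticSubalgebra.isDomain hne hI'
  rw [algebraicOver_iff hf.1 hg] at halg
  rw [algebraicOver_iff hf.1 hg.deriv, ← derivation_mk hI g hg]
  intro hind
  refine (derivation hI).isAlgebraic_of_isAlgebraic (fun y hy =>
    (derivation hI).isAlgebraic_of_mem_adjoin ?_ hy) (halg hind)
  rintro _ ⟨i, rfl⟩
  refine Fin.cases ?_ (fun i => ?_) i
  · have h : derivation hI (consId f hf.1 0) = 1 := by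
      refine (derivation_mk hI id analyticOnNhd_id).trans (Subtype.ext (funext fun x => ?_))
      exact deriv_id _
    rw [h]
    exact isAlgebraic_one
  · have h : derivation hI (consId f hf.1 i.succ) = mk (deriv (f i)) (hf.1 i).deriv :=
      derivation_mk hI (f i) (hf.1 i)
    rw [h]
    have hsub : consId (fun j : Fin ((i : ℕ) + 1) => f (Fin.castLE i.isLt j)) (fun _ => hf.1 _) =
        consId f hf.1 ∘ Fin.castLE (Nat.succ_le_succ i.isLt) := by
      ext1 j
      refine Fin.cases rfl (fun j => rfl) j
    have hi := (algebraicOver_iff (fun _ => hf.1 _) (hf.1 i).deriv).1 (hf.2 i)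
    rw [hsub] at hi
    exact (hi (hind.comp _ (Fin.castLE_injective _))).tower_top_of_subalgebra_le
      (Algebra.adjoin_mono (Set.range_comp_subset_range _ _))

/-- Closure under differentiation: if `g` is real analytic on a nonempty open interval
`I` and algebraic over `(x, f₁,…,f_m)` for a Pfaffian chain `f₁,…,f_m` on `I`, then
every iterated derivative `g^{(r)}` is algebraic over `(x, f₁,…,f_m)`. -/
theorem iteratedDeriv_algebraic_over_pfaffian_chain
    (I : Set ℝ) (a b : ℝ) (hab : a < b) (hI : I = Set.Ioo a b)
    (m : ℕ) (f : Fin m → ℝ → ℝ) (hf : IsPfaffianChain I f)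
    (g : ℝ → ℝ) (hg : AnalyticOnNhd ℝ g I)
    (halg : AlgebraicOver I f g) :
    ∀ r : ℕ, AlgebraicOver I f (deriv^[r] g) := by
  subst hI
  have hderiv : ∀ r : ℕ, AnalyticOnNhd ℝ (deriv^[r] g) (Set.Ioo a b) ∧
      AlgebraicOver (Set.Ioo a b) f (deriv^[r] g) := by
    intro r
    induction r with
    | zero => exact ⟨hg, halg⟩
    | succ r ih =>
      rw [Function.iterate_succ_apply']
      exact ⟨ih.1.deriv, ih.2.deriv_of_isPfaffianChain (Set.nonempty_Ioo.2 hab) isOpen_Ioo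
        isPreconnected_Ioo hf ih.1⟩
  exact fun r => (hderiv r).2
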